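/- arXiv:1209.3690 — 3 statements merged into one kernel-verified Lean document; each statement's English description precedes it below -/
import Mathlib

section
/- Let α and β be non-increasing weight sequences, with c^α_0 = 1, c^α_j = α_j^{-1} − α_{j-1}^{-1} (j ≥ 1) and c^β_0 = 1, c^β_j = β_j^{-1} − β_{j-1}^{-1} (j ≥ 1), and let Ψ_α(z) : ℓ²(U) → U and Ψ_β(z) : ℓ²(Y) → Y be the bounded operators (u_j) ↦ Σ_{j≥0} √(c^α_j) z^j u_j and (y_j) ↦ Σ_{j≥0} √(c^β_j) z^j y_j. Then an analytic function S : 𝔻 → L(U,Y) is a contractive multiplier from H²_α(U) to H²_β(Y) if and only if there exists 𝐒 in the Schur class S(ℓ²(U), ℓ²(Y)) such that S(z) Ψ_α(z) = Ψ_β(z) 𝐒(z) as operators from ℓ²(U) to Y, for all z ∈ 𝔻. -/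
open Metric Filter

noncomputable section

/-- `β` is a weight sequence: positive, `β 0 = 1`, and `liminf β_j^(1/j) ≥ 1`. -/
def IsWeightSeq (β : ℕ → ℝ) : Prop :=
  (∀ j, 0 < β j) ∧ β 0 = 1 ∧
    1 ≤ Filter.liminf (fun j : ℕ => β j ^ ((1 : ℝ) / j)) Filter.atTop

/-- `S`, with Taylor coefficients `Sc`, is a contractive multiplier from `H²_α(U)` to
`H²_β(Y)`. -/
def IsContractiveMultiplierW {U Y : Type*} [NormedAddCommGroup U] [InnerProductSpace ℂ U]
    [NormedAddCommGroup Y] [InnerProductSpace ℂ Y]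
    (α β : ℕ → ℝ) (Sc : ℕ → (U →L[ℂ] Y)) : Prop :=
  ∀ h : ℕ → U, Summable (fun k => α k * ‖h k‖ ^ 2) →
    Summable (fun ℓ => β ℓ * ‖∑ j ∈ Finset.range (ℓ + 1), Sc j (h (ℓ - j))‖ ^ 2) ∧
    ∑' ℓ, β ℓ * ‖∑ j ∈ Finset.range (ℓ + 1), Sc j (h (ℓ - j))‖ ^ 2
      ≤ ∑' k, α k * ‖h k‖ ^ 2

/-- The Schur class: analytic on the unit disk with contractive values. -/
def IsSchur {U V : Type*} [NormedAddCommGroup U] [NormedSpace ℂ U]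
    [NormedAddCommGroup V] [NormedSpace ℂ V] (F : ℂ → (U →L[ℂ] V)) : Prop :=
  AnalyticOn ℂ F (ball 0 1) ∧ ∀ z ∈ ball (0 : ℂ) 1, ‖F z‖ ≤ 1

/-- A norm-preserving correspondence `a g ↦ b g` between Hilbert spaces extends to a globally
defined contraction. -/
theorem exists_contraction_comp_eq {G H K : Type*} [AddCommGroup G] [Module ℂ G]
    [NormedAddCommGroup H] [InnerProductSpace ℂ H] [CompleteSpace H]
    [NormedAddCommGroup K] [InnerProductSpace ℂ K] [CompleteSpace K]
    (a : G →ₗ[ℂ] H) (b : G →ₗ[ℂ] K) (hab : ∀ g, ‖b g‖ ≤ ‖a g‖) :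
    ∃ W : H →L[ℂ] K, ‖W‖ ≤ 1 ∧ ∀ g, W (a g) = b g := by
  set R := (LinearMap.range a).topologicalClosure
  have : CompleteSpace R := (LinearMap.range a).isClosed_topologicalClosure.completeSpace_coe
  have hmem : ∀ g, a g ∈ R := fun g =>
    (LinearMap.range a).le_topologicalClosure (LinearMap.mem_range_self a g)
  let e : G →ₗ[ℂ] R := a.codRestrict R hmem
  have he : DenseRange e := by
    intro x
    rw [closure_subtype]
    have hx : (x : H) ∈ closure (LinearMap.range a : Set H) := x.2
    convert hx using 2
    ext y
    simp only [Set.mem_image, Set.mem_range, SetLike.mem_coe, LinearMap.mem_range]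
    exact ⟨fun ⟨_, ⟨g, hg⟩, hy⟩ => ⟨g, by rw [← hy, ← hg]; rfl⟩,
      fun ⟨g, hg⟩ => ⟨e g, ⟨g, rfl⟩, hg⟩⟩
  have hn : ∀ g, ‖b g‖ ≤ 1 * ‖e g‖ := fun g => by rw [one_mul]; exact hab g
  refine ⟨(b.extendOfNorm e).comp R.orthogonalProjectionOnto, ?_, fun g => ?_⟩
  · refine (ContinuousLinearMap.opNorm_comp_le _ _).trans ?_
    exact mul_le_one₀ (LinearMap.opNorm_extendOfNorm_le he zero_le_one hn) (norm_nonneg _)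
      R.orthogonalProjectionOnto_norm_le
  · have : R.orthogonalProjectionOnto (a g) = e g :=
      R.orthogonalProjectionOnto_mem_subspace_eq_self (e g)
    rw [ContinuousLinearMap.comp_apply, this]
    exact LinearMap.extendOfNorm_eq he ⟨1, hn⟩ g

/-- The transfer function of a contractive system matrix is in the Schur class. -/
theorem exists_isSchur_of_contraction {H M N : Type*}
    [NormedAddCommGroup H] [InnerProductSpace ℂ H] [CompleteSpace H]
    [NormedAddCommGroup M] [InnerProductSpace ℂ M] [CompleteSpace M]
    [NormedAddCommGroup N] [InnerProductSpace ℂ N] [CompleteSpace N]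
    (V : WithLp 2 (H × N) →L[ℂ] WithLp 2 (H × M)) (hV : ‖V‖ ≤ 1) :
    ∃ F : ℂ → (N →L[ℂ] M), IsSchur F ∧ ∀ z ∈ ball (0 : ℂ) 1, ∀ f : N, ∃ x : H,
      V (WithLp.toLp 2 (z • x, f)) = WithLp.toLp 2 (x, F z f) := by
  let E := (WithLp.prodContinuousLinearEquiv 2 ℂ H N).symm.toContinuousLinearMap
  let i₁ : H →L[ℂ] WithLp 2 (H × N) := E.comp (ContinuousLinearMap.inl ℂ H N)
  let i₂ : N →L[ℂ] WithLp 2 (H × N) := E.comp (ContinuousLinearMap.inr ℂ H N)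
  let p : H →L[ℂ] H := (WithLp.fstL 2 ℂ H M).comp (V.comp i₁)
  let r : N →L[ℂ] H := (WithLp.fstL 2 ℂ H M).comp (V.comp i₂)
  let q : H →L[ℂ] M := (WithLp.sndL 2 ℂ H M).comp (V.comp i₁)
  let t : N →L[ℂ] M := (WithLp.sndL 2 ℂ H M).comp (V.comp i₂)
  have hVx : ∀ x f, V (WithLp.toLp 2 (x, f)) = WithLp.toLp 2 (p x + r f, q x + t f) := by
    intro x f
    have : WithLp.toLp 2 (x, f) = i₁ x + i₂ f := by
      change _ = WithLp.toLp 2 (x, 0) + WithLp.toLp 2 (0, f)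
      rw [← WithLp.toLp_add]; simp
    rw [this, map_add]
    rfl
  have hsq : ∀ x f, ‖p x + r f‖ ^ 2 + ‖q x + t f‖ ^ 2 ≤ ‖x‖ ^ 2 + ‖f‖ ^ 2 := by
    intro x f
    have h := V.le_of_opNorm_le hV (WithLp.toLp 2 (x, f))
    rw [one_mul, hVx] at h
    have h2 := pow_le_pow_left₀ (norm_nonneg _) h 2
    rwa [WithLp.prod_norm_sq_eq_of_L2, WithLp.prod_norm_sq_eq_of_L2] at h2
  have hp : ‖p‖ ≤ 1 := by
    refine ContinuousLinearMap.opNorm_le_bound _ zero_le_one fun x => ?_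
    have := hsq x 0
    simp only [map_zero, add_zero, norm_zero] at this
    rw [one_mul]
    refine le_of_sq_le_sq ?_ (norm_nonneg _)
    nlinarith [sq_nonneg ‖q x‖]
  have hunit : ∀ z ∈ ball (0 : ℂ) 1, IsUnit (1 - z • p) := by
    intro z hz
    refine isUnit_one_sub_of_norm_lt_one ?_
    rw [norm_smul]
    rw [mem_ball_zero_iff] at hz
    nlinarith [norm_nonneg z, norm_nonneg p]
  let F : ℂ → (N →L[ℂ] M) := fun z => t + z • q.comp ((Ring.inverse (1 - z • p)).comp r)
  have hF : ∀ z ∈ ball (0 : ℂ) 1, ∀ f : N, ∃ x : H,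
      p (z • x) + r f = x ∧ q (z • x) + t f = F z f := by
    intro z hz f
    refine ⟨Ring.inverse (1 - z • p) (r f), ?_, ?_⟩
    · have := congrArg (fun A : H →L[ℂ] H => A (r f)) (Ring.mul_inverse_cancel _ (hunit z hz))
      simp only [mul_apply_eq_comp, sub_apply, one_apply_eq_self,
        smul_apply] at this
      rw [map_smul, add_comm]
      exact (sub_eq_iff_eq_add.mp this).symm
    · rw [map_smul, add_comm]
      rfl
  refine ⟨F, ⟨?_, fun z hz => ?_⟩, fun z hz f => ?_⟩
  · refine DifferentiableOn.analyticOn (fun z hz => DifferentiableAt.differentiableWithinAt ?_)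
      isOpen_ball
    have h0 : DifferentiableAt ℂ (fun z : ℂ => 1 - z • p) z :=
      (differentiableAt_id.smul_const p).const_sub 1
    have h1 : DifferentiableAt ℂ (fun z : ℂ => Ring.inverse (1 - z • p)) z :=
      DifferentiableAt.comp (g := Ring.inverse) z (differentiableAt_inverse (hunit z hz)) h0
    have h2 : DifferentiableAt ℂ (fun z : ℂ => q.comp ((Ring.inverse (1 - z • p)).comp r)) z :=
      (differentiableAt_const q).clm_comp (h1.clm_comp (differentiableAt_const r))
    exact (differentiableAt_id.smul h2).const_add t
  · refine ContinuousLinearMap.opNorm_le_bound _ zero_le_one fun f => ?_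
    obtain ⟨x, h1, h2⟩ := hF z hz f
    have := hsq (z • x) f
    rw [h1, h2, norm_smul] at this
    rw [mem_ball_zero_iff] at hz
    rw [one_mul]
    refine le_of_sq_le_sq ?_ (norm_nonneg _)
    have h3 : (‖z‖ * ‖x‖) ^ 2 ≤ ‖x‖ ^ 2 :=
      pow_le_pow_left₀ (by positivity) (mul_le_of_le_one_left (norm_nonneg _) hz.le) 2
    linarith
  · obtain ⟨x, h1, h2⟩ := hF z hz f
    exact ⟨x, by rw [hVx, h1, h2]⟩

/-- The lurking isometry argument. -/
theorem exists_isSchur_of_lurking_isometry {G H M N : Type*} [AddCommGroup G] [Module ℂ G]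
    [NormedAddCommGroup H] [InnerProductSpace ℂ H] [CompleteSpace H]
    [NormedAddCommGroup M] [InnerProductSpace ℂ M] [CompleteSpace M]
    [NormedAddCommGroup N] [InnerProductSpace ℂ N] [CompleteSpace N]
    (D D' : G →ₗ[ℂ] H) (P : G →ₗ[ℂ] M) (Q : G →ₗ[ℂ] N)
    (h : ∀ g, ‖D' g‖ ^ 2 + ‖P g‖ ^ 2 = ‖D g‖ ^ 2 + ‖Q g‖ ^ 2) :
    ∃ F : ℂ → (N →L[ℂ] M), IsSchur F ∧ ∀ z ∈ ball (0 : ℂ) 1, ∀ g,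
      D' g = starRingEnd ℂ z • D g → ∀ f : N, inner ℂ (P g) (F z f) = inner ℂ (Q g) f := by
  let a : G →ₗ[ℂ] WithLp 2 (H × M) :=
    (WithLp.linearEquiv 2 ℂ (H × M)).symm.toLinearMap ∘ₗ D'.prod P
  let b : G →ₗ[ℂ] WithLp 2 (H × N) :=
    (WithLp.linearEquiv 2 ℂ (H × N)).symm.toLinearMap ∘ₗ D.prod Q
  obtain ⟨W, hW, hWab⟩ := exists_contraction_comp_eq a b fun g => by
    refine le_of_sq_le_sq ?_ (norm_nonneg _)
    rw [WithLp.prod_norm_sq_eq_of_L2, WithLp.prod_norm_sq_eq_of_L2]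
    exact (h g).ge
  obtain ⟨F, hF, hFV⟩ := exists_isSchur_of_contraction (ContinuousLinearMap.adjoint W)
    (by rwa [LinearIsometryEquiv.norm_map])
  refine ⟨F, hF, fun z hz g hg f => ?_⟩
  obtain ⟨x, hx⟩ := hFV z hz f
  have key := ContinuousLinearMap.adjoint_inner_right W (a g) (WithLp.toLp 2 (z • x, f))
  rw [hx, hWab, WithLp.prod_inner_apply, WithLp.prod_inner_apply] at key
  change inner ℂ (D' g) x + inner ℂ (P g) (F z f) = inner ℂ (D g) (z • x) + inner ℂ (Q g) f at key
  rw [hg, inner_smul_left, inner_smul_right, Complex.conj_conj] at key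
  exact add_left_cancel key

section PowerSeries

variable {E F : Type*} [NormedAddCommGroup E] [NormedSpace ℂ E]
  [NormedAddCommGroup F] [NormedSpace ℂ F]

/-- Power series convergent on the open unit disk converge absolutely there. -/
theorem summable_pow_mul_norm_of_summable_ball {a : ℕ → E}
    (h : ∀ z ∈ ball (0 : ℂ) 1, Summable fun j => z ^ j • a j) {r : ℝ} (hr0 : 0 ≤ r) (hr : r < 1) :
    Summable fun j => r ^ j * ‖a j‖ := by
  obtain ⟨s, hrs, hs⟩ := exists_between hr
  have hs0 : 0 < s := hr0.trans_lt hrs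
  have hsball : (s : ℂ) ∈ ball (0 : ℂ) 1 := by
    rw [mem_ball_zero_iff, Complex.norm_real, Real.norm_of_nonneg hs0.le]; exact hs
  obtain ⟨C, hC⟩ := (h s hsball).tendsto_atTop_zero.norm.bddAbove_range
  have hgeo : Summable fun j : ℕ => C * (r / s) ^ j :=
    (summable_geometric_of_lt_one (by positivity) ((div_lt_one hs0).2 hrs)).mul_left C
  refine Summable.of_nonneg_of_le (fun j => by positivity) (fun j => ?_) hgeo
  have h1 : s ^ j * ‖a j‖ ≤ C := by
    have := hC ⟨j, rfl⟩
    simpa [norm_smul, abs_of_pos hs0] using this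
  calc r ^ j * ‖a j‖ = (s ^ j * ‖a j‖) * (r / s) ^ j := by
        rw [div_pow]; field_simp
    _ ≤ C * (r / s) ^ j := by gcongr

theorem norm_pow_smul_eq (z : ℂ) (a : ℕ → E) (j : ℕ) : ‖z ^ j • a j‖ = ‖z‖ ^ j * ‖a j‖ := by
  rw [norm_smul, norm_pow]

/-- The coefficients of the product of an operator-valued and a vector-valued power series. -/
def seriesConv (L : ℕ → (E →L[ℂ] F)) (e : ℕ → E) (n : ℕ) : F :=
  ∑ ij ∈ Finset.HasAntidiagonal.antidiagonal n, L ij.1 (e ij.2)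

theorem seriesConv_eq_range (L : ℕ → (E →L[ℂ] F)) (e : ℕ → E) (n : ℕ) :
    seriesConv L e n = ∑ j ∈ Finset.range (n + 1), L j (e (n - j)) :=
  Finset.Nat.sum_antidiagonal_eq_sum_range_succ (fun i j => L i (e j)) n

/-- Cauchy product of an operator-valued and a vector-valued power series on the unit disk. -/
theorem hasSum_pow_smul_seriesConv [CompleteSpace F] {L : ℕ → (E →L[ℂ] F)} {e : ℕ → E}
    {Lf : ℂ → (E →L[ℂ] F)} {ef : ℂ → E}
    (hL : ∀ z ∈ ball (0 : ℂ) 1, HasSum (fun j => z ^ j • L j) (Lf z))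
    (he : ∀ z ∈ ball (0 : ℂ) 1, HasSum (fun j => z ^ j • e j) (ef z)) :
    ∀ z ∈ ball (0 : ℂ) 1, HasSum (fun n => z ^ n • seriesConv L e n) (Lf z (ef z)) := by
  intro z hz
  have hz1 : ‖z‖ < 1 := by simpa using hz
  have sL := summable_pow_mul_norm_of_summable_ball (fun w hw => (hL w hw).summable)
    (norm_nonneg z) hz1
  have se := summable_pow_mul_norm_of_summable_ball (fun w hw => (he w hw).summable)
    (norm_nonneg z) hz1
  have hprod : Summable fun p : ℕ × ℕ => (z ^ p.1 • L p.1) (z ^ p.2 • e p.2) := by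
    refine Summable.of_norm_bounded (sL.mul_of_nonneg se (fun _ => by positivity)
      (fun _ => by positivity)) fun p => ?_
    rw [← norm_pow_smul_eq, ← norm_pow_smul_eq]
    exact ContinuousLinearMap.le_opNorm _ _
  have hsum : HasSum (fun p : ℕ × ℕ => (z ^ p.1 • L p.1) (z ^ p.2 • e p.2)) (Lf z (ef z)) := by
    have h1 : ∀ i, HasSum (fun j => (z ^ i • L i) (z ^ j • e j)) ((z ^ i • L i) (ef z)) :=
      fun i => (he z hz).mapL (z ^ i • L i)
    have h2 : HasSum (fun i => (z ^ i • L i) (ef z)) (Lf z (ef z)) :=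
      (hL z hz).mapL (ContinuousLinearMap.apply ℂ F (ef z))
    have h3 := hprod.hasSum.prod_fiberwise h1
    rw [h2.unique h3]
    exact hprod.hasSum
  have h4 := (Finset.HasAntidiagonal.sigmaAntidiagonalEquivProd (A := ℕ)).hasSum_iff.2 hsum
  refine (h4.sigma fun n => hasSum_fintype _).congr_fun fun n => ?_
  rw [seriesConv, Finset.smul_sum, ← Finset.sum_coe_sort]
  refine Finset.sum_congr rfl fun p _ => ?_
  have hp : (p : ℕ × ℕ).1 + (p : ℕ × ℕ).2 = n := Finset.HasAntidiagonal.mem_antidiagonal.1 p.2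
  simp only [← hp, pow_add, mul_smul, Function.comp_apply, smul_apply, map_smul]
  exact smul_comm _ _ _

theorem eq_of_hasSum_pow_smul {a b : ℕ → E} {f : ℂ → E}
    (ha : ∀ z ∈ ball (0 : ℂ) 1, HasSum (fun j => z ^ j • a j) (f z))
    (hb : ∀ z ∈ ball (0 : ℂ) 1, HasSum (fun j => z ^ j • b j) (f z)) : a = b := by
  have key : ∀ c : ℕ → E, (∀ z ∈ ball (0 : ℂ) 1, HasSum (fun j => z ^ j • c j) (f z)) →
      HasFPowerSeriesAt f (show FormalMultilinearSeries ℂ ℂ E from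
        fun n => ContinuousMultilinearMap.mkPiRing ℂ (Fin n) (c n)) 0 := by
    intro c hc
    refine hasFPowerSeriesAt_iff.2 ?_
    filter_upwards [ball_mem_nhds (0 : ℂ) one_pos] with z hz
    simpa [FormalMultilinearSeries.coeff] using hc z hz
  have := (key a ha).eq_formalMultilinearSeries (key b hb)
  ext n
  simpa using congrArg (fun m => m fun _ => (1 : ℂ)) (congrFun this n)

end PowerSeries

section Hardy

variable {E F : Type*} [NormedAddCommGroup E] [InnerProductSpace ℂ E]
  [NormedAddCommGroup F] [InnerProductSpace ℂ F]

/-- Parseval's identity for vector polynomials sampled at roots of unity. -/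
theorem sum_norm_sq_rootsOfUnity {K : ℕ} {ζ : ℂ} (hζ : IsPrimitiveRoot ζ K) (hK : 0 < K)
    (a : ℕ → E) :
    ∑ k ∈ Finset.range K, ‖∑ n ∈ Finset.range K, (ζ ^ k) ^ n • a n‖ ^ 2 =
      K * ∑ n ∈ Finset.range K, ‖a n‖ ^ 2 := by
  have hnorm : ‖ζ‖ = 1 := hζ.norm'_eq_one hK.ne'
  have hconj : starRingEnd ℂ ζ * ζ = 1 := by
    rw [Complex.conj_mul', hnorm]; simp
  have hζ0 : ζ ≠ 0 := fun h => by simp [h] at hnorm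
  have orth : ∀ n ∈ Finset.range K, ∀ m ∈ Finset.range K,
      ∑ k ∈ Finset.range K, starRingEnd ℂ ((ζ ^ k) ^ n) * (ζ ^ k) ^ m =
        if n = m then (K : ℂ) else 0 := by
    intro n hn m hm
    have hc : starRingEnd ℂ ζ = ζ⁻¹ := eq_inv_of_mul_eq_one_left hconj
    have hterm : ∀ k, starRingEnd ℂ ((ζ ^ k) ^ n) * (ζ ^ k) ^ m = (ζ⁻¹ ^ n * ζ ^ m) ^ k := by
      intro k; rw [map_pow, map_pow, hc]; ring
    simp_rw [hterm]
    split_ifs with h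
    · subst h
      simp [inv_mul_cancel₀ (pow_ne_zero n hζ0)]
    · have hne : ζ⁻¹ ^ n * ζ ^ m ≠ 1 := by
        intro h1
        apply h
        have : ζ ^ m = ζ ^ n := by
          rw [inv_pow, inv_mul_eq_one₀ (pow_ne_zero _ hζ0)] at h1
          exact h1.symm
        exact (hζ.pow_inj (Finset.mem_range.1 hm) (Finset.mem_range.1 hn) this).symm
      rw [geom_sum_eq hne, mul_pow, ← pow_mul, ← pow_mul, mul_comm n, mul_comm m, pow_mul, pow_mul,
        inv_pow, hζ.pow_eq_one]
      simp
  have hC : ((∑ k ∈ Finset.range K, ‖∑ n ∈ Finset.range K, (ζ ^ k) ^ n • a n‖ ^ 2 : ℝ) : ℂ) =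
      ((K * ∑ n ∈ Finset.range K, ‖a n‖ ^ 2 : ℝ) : ℂ) := by
    push_cast
    calc _ = ∑ k ∈ Finset.range K, ∑ n ∈ Finset.range K, ∑ m ∈ Finset.range K,
          (starRingEnd ℂ ((ζ ^ k) ^ n) * (ζ ^ k) ^ m) * inner ℂ (a n) (a m) := by
          refine Finset.sum_congr rfl fun k _ => ?_
          rw [← Complex.ofReal_pow]
          have := inner_self_eq_norm_sq_to_K (𝕜 := ℂ) (∑ n ∈ Finset.range K, (ζ ^ k) ^ n • a n)
          push_cast
          refine Eq.trans this.symm ?_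
          simp only [sum_inner, inner_sum, inner_smul_left, inner_smul_right, mul_assoc,
            Finset.mul_sum]
          rw [Finset.sum_comm]
          refine Finset.sum_congr rfl fun n _ => Finset.sum_congr rfl fun m _ => ?_
          ring
      _ = ∑ n ∈ Finset.range K, ∑ m ∈ Finset.range K,
          (if n = m then (K : ℂ) else 0) * inner ℂ (a n) (a m) := by
          rw [Finset.sum_comm]
          refine Finset.sum_congr rfl fun n hn => ?_
          rw [Finset.sum_comm]
          refine Finset.sum_congr rfl fun m hm => ?_
          rw [← Finset.sum_mul, orth n hn m hm]
      _ = _ := by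
          rw [Finset.mul_sum]
          refine Finset.sum_congr rfl fun n hn => ?_
          simp [ite_mul, Finset.sum_ite_eq, Finset.mem_range.1 hn]
  exact_mod_cast hC

theorem sum_norm_sq_circle {K : ℕ} {ζ : ℂ} (hζ : IsPrimitiveRoot ζ K) (hK : 0 < K)
    {r : ℝ} (hr : 0 ≤ r) (a : ℕ → E) :
    ∑ k ∈ Finset.range K, ‖∑ n ∈ Finset.range K, ((r : ℂ) * ζ ^ k) ^ n • a n‖ ^ 2 =
      K * ∑ n ∈ Finset.range K, (r ^ n * ‖a n‖) ^ 2 := by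
  have := sum_norm_sq_rootsOfUnity hζ hK fun n => (r : ℂ) ^ n • a n
  simpa only [norm_smul, norm_pow, Complex.norm_real, Real.norm_of_nonneg hr, smul_smul, mul_pow,
    mul_comm] using this

/-- A Schur class function maps the Hardy space contractively into the Hardy space; stated for
polynomial inputs and finitely many output coefficients. -/
theorem IsSchur.sum_norm_sq_seriesConv_le [CompleteSpace F]
    {f : ℂ → (E →L[ℂ] F)} (hf : IsSchur f)
    {L : ℕ → (E →L[ℂ] F)} (hL : ∀ z ∈ ball (0 : ℂ) 1, HasSum (fun j => z ^ j • L j) (f z))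
    {e : ℕ → E} {N : ℕ} (he : ∀ m, N ≤ m → e m = 0) :
    ∑ n ∈ Finset.range N, ‖seriesConv L e n‖ ^ 2 ≤ ∑ m ∈ Finset.range N, ‖e m‖ ^ 2 := by
  set G := seriesConv L e
  let u : ℂ → E := fun z => ∑ m ∈ Finset.range N, z ^ m • e m
  have hsupp : ∀ z : ℂ, ∀ m ∉ Finset.range N, z ^ m • e m = 0 := fun z m hm => by
    rw [he m (by simpa using hm), smul_zero]
  have hu : ∀ z ∈ ball (0 : ℂ) 1, HasSum (fun m => z ^ m • e m) (u z) := fun z _ =>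
    hasSum_sum_of_ne_finset_zero (hsupp z)
  have hG : ∀ z ∈ ball (0 : ℂ) 1, HasSum (fun n => z ^ n • G n) (f z (u z)) :=
    hasSum_pow_smul_seriesConv hL hu
  set A := ∑ m ∈ Finset.range N, ‖e m‖ ^ 2
  set C := ∑ m ∈ Finset.range N, ‖e m‖
  have hr : ∀ r : ℝ, 0 < r → r < 1 → ∑ n ∈ Finset.range N, (r ^ n * ‖G n‖) ^ 2 ≤ A := by
    intro r hr0 hr1
    have sG := summable_pow_mul_norm_of_summable_ball (fun w hw => (hG w hw).summable) hr0.le hr1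
    let δ : ℕ → ℝ := fun K => ∑' n, r ^ (n + K) * ‖G (n + K)‖
    have hδ : Tendsto δ atTop (nhds 0) := tendsto_sum_nat_add fun n => r ^ n * ‖G n‖
    have hbound : ∀ K, N ≤ K → 0 < K →
        ∑ n ∈ Finset.range N, (r ^ n * ‖G n‖) ^ 2 ≤ A + 2 * δ K * C + δ K ^ 2 := by
      intro K hNK hK
      have hδ0 : 0 ≤ δ K := tsum_nonneg fun n => by positivity
      have hζ := Complex.isPrimitiveRoot_exp K hK.ne'
      set ζ := Complex.exp (2 * Real.pi * Complex.I / K)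
      have hnorm : ‖ζ‖ = 1 := hζ.norm'_eq_one hK.ne'
      have hzn : ∀ k, ‖(r : ℂ) * ζ ^ k‖ = r := fun k => by
        simp [hnorm, abs_of_pos hr0]
      have hzb : ∀ k, (r : ℂ) * ζ ^ k ∈ ball (0 : ℂ) 1 := fun k => by
        rw [mem_ball_zero_iff, hzn]; exact hr1
      have huC : ∀ k, ‖u (r * ζ ^ k)‖ ≤ C := by
        intro k
        refine (norm_sum_le _ _).trans (Finset.sum_le_sum fun m _ => ?_)
        rw [norm_pow_smul_eq, hzn]
        exact mul_le_of_le_one_left (norm_nonneg _) (pow_le_one₀ hr0.le hr1.le)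
      have htrunc : ∀ k, ‖∑ n ∈ Finset.range K, ((r : ℂ) * ζ ^ k) ^ n • G n‖ ≤
          ‖u (r * ζ ^ k)‖ + δ K := by
        intro k
        have h1 := (hG _ (hzb k)).summable.sum_add_tsum_nat_add K
        rw [(hG _ (hzb k)).tsum_eq] at h1
        rw [eq_sub_of_add_eq h1]
        refine (norm_sub_le _ _).trans (add_le_add ?_ ?_)
        · exact ((f _).le_of_opNorm_le (hf.2 _ (hzb k)) _).trans_eq (one_mul _)
        · have hs := (summable_nat_add_iff K).2 sG
          refine tsum_of_norm_bounded hs.hasSum fun n => ?_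
          rw [norm_pow_smul_eq, hzn]
      have huK : ∀ z, u z = ∑ n ∈ Finset.range K, z ^ n • e n := fun z =>
        Finset.sum_subset (Finset.range_mono hNK) fun m _ hm => hsupp z m hm
      have hKpos : (0 : ℝ) < K := Nat.cast_pos.2 hK
      have heA : ∑ n ∈ Finset.range K, (r ^ n * ‖e n‖) ^ 2 ≤ A := by
        rw [← Finset.sum_subset (Finset.range_mono hNK) fun m _ hm => by
          rw [he m (by simpa using hm)]; simp]
        refine Finset.sum_le_sum fun m _ => pow_le_pow_left₀ (by positivity) ?_ 2
        exact mul_le_of_le_one_left (norm_nonneg _) (pow_le_one₀ hr0.le hr1.le)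
      have hmul : K * ∑ n ∈ Finset.range K, (r ^ n * ‖G n‖) ^ 2 ≤
          K * (A + 2 * δ K * C + δ K ^ 2) :=
        calc K * ∑ n ∈ Finset.range K, (r ^ n * ‖G n‖) ^ 2
            = ∑ k ∈ Finset.range K, ‖∑ n ∈ Finset.range K, ((r : ℂ) * ζ ^ k) ^ n • G n‖ ^ 2 :=
              (sum_norm_sq_circle hζ hK hr0.le G).symm
          _ ≤ ∑ k ∈ Finset.range K, (‖u (r * ζ ^ k)‖ ^ 2 + (2 * δ K * C + δ K ^ 2)) := by
              refine Finset.sum_le_sum fun k _ => ?_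
              refine (pow_le_pow_left₀ (norm_nonneg _) (htrunc k) 2).trans ?_
              nlinarith [mul_le_mul_of_nonneg_left (huC k) hδ0]
          _ = K * (∑ n ∈ Finset.range K, (r ^ n * ‖e n‖) ^ 2) +
                K * (2 * δ K * C + δ K ^ 2) := by
              rw [Finset.sum_add_distrib, ← sum_norm_sq_circle hζ hK hr0.le e]
              simp only [huK, Finset.sum_const, Finset.card_range, nsmul_eq_mul]
          _ ≤ K * (A + 2 * δ K * C + δ K ^ 2) := by
              rw [← mul_add]
              exact mul_le_mul_of_nonneg_left (by linarith) hKpos.le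
      refine (Finset.sum_le_sum_of_subset_of_nonneg (Finset.range_mono hNK)
        fun _ _ _ => sq_nonneg _).trans ?_
      exact le_of_mul_le_mul_left hmul hKpos
    have hlim : Tendsto (fun K => A + 2 * δ K * C + δ K ^ 2) atTop (nhds (A + 2 * 0 * C + 0 ^ 2)) :=
      ((tendsto_const_nhds.add ((hδ.const_mul 2).mul_const C)).add (hδ.pow 2))
    have := ge_of_tendsto hlim (eventually_atTop.2 ⟨N + 1, fun K hK =>
      hbound K (by omega) (by omega)⟩)
    simpa using this
  have hcont : Tendsto (fun r : ℝ => ∑ n ∈ Finset.range N, (r ^ n * ‖G n‖) ^ 2)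
      (nhdsWithin 1 (Set.Iio 1)) (nhds (∑ n ∈ Finset.range N, (1 ^ n * ‖G n‖) ^ 2)) := by
    refine Tendsto.mono_left (Continuous.tendsto ?_ 1) nhdsWithin_le_nhds
    fun_prop
  have hfin := le_of_tendsto hcont (by
    filter_upwards [Ioo_mem_nhdsLT (zero_lt_one (α := ℝ))] with r hr'
    exact hr r hr'.1 hr'.2)
  simpa using hfin

end Hardy

theorem IsSchur.exists_hasSum {E F : Type*} [NormedAddCommGroup E] [NormedSpace ℂ E]
    [NormedAddCommGroup F] [NormedSpace ℂ F] [CompleteSpace F] {f : ℂ → (E →L[ℂ] F)}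
    (hf : IsSchur f) :
    ∃ L : ℕ → (E →L[ℂ] F), ∀ z ∈ ball (0 : ℂ) 1, HasSum (fun j => z ^ j • L j) (f z) := by
  refine ⟨fun n => (n.factorial : ℂ)⁻¹ • iteratedDeriv n f 0, fun z hz => ?_⟩
  refine (Complex.hasSum_taylorSeries_on_ball hf.1.differentiableOn hz).congr_fun fun n => ?_
  rw [sub_zero, smul_comm]

/-- The defect operator of a contraction. -/
theorem exists_norm_sq_eq_sub_norm_sq_adjoint {H K : Type*}
    [NormedAddCommGroup H] [InnerProductSpace ℂ H] [CompleteSpace H]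
    [NormedAddCommGroup K] [InnerProductSpace ℂ K] [CompleteSpace K]
    (X : H →L[ℂ] K) (hX : ‖X‖ ≤ 1) :
    ∃ D : K →L[ℂ] K, ∀ g, ‖D g‖ ^ 2 = ‖g‖ ^ 2 - ‖ContinuousLinearMap.adjoint X g‖ ^ 2 := by
  set A := ContinuousLinearMap.adjoint X
  set T : K →L[ℂ] K := 1 - X.comp A
  have hTinner : ∀ x, RCLike.re (inner ℂ (T x) x) = ‖x‖ ^ 2 - ‖A x‖ ^ 2 := by
    intro x
    have h1 : inner ℂ (T x) x = inner ℂ x x - inner ℂ (A x) (A x) := by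
      simp only [T, sub_apply, one_apply_eq_self, inner_sub_left, ContinuousLinearMap.comp_apply]
      rw [ContinuousLinearMap.adjoint_inner_right]
    rw [h1, map_sub, inner_self_eq_norm_sq, inner_self_eq_norm_sq]
  have hA : ‖A‖ ≤ 1 := by rwa [LinearIsometryEquiv.norm_map]
  have hsa : IsSelfAdjoint T := by
    refine (IsSelfAdjoint.one _).sub ?_
    exact (ContinuousLinearMap.isPositive_self_comp_adjoint X).isSelfAdjoint
  have hT : 0 ≤ T := by
    rw [ContinuousLinearMap.nonneg_iff_isPositive, ContinuousLinearMap.isPositive_def']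
    refine ⟨hsa, fun x => ?_⟩
    rw [ContinuousLinearMap.reApplyInnerSelf_apply, hTinner, sub_nonneg]
    exact pow_le_pow_left₀ (norm_nonneg _)
      ((A.le_of_opNorm_le hA x).trans_eq (one_mul _)) 2
  have hD : (CFC.sqrt T).IsPositive :=
    (ContinuousLinearMap.nonneg_iff_isPositive _).1 (CFC.sqrt_nonneg T)
  refine ⟨CFC.sqrt T, fun g => ?_⟩
  rw [← hTinner, ← inner_self_eq_norm_sq (𝕜 := ℂ), ← hD.inner_left_eq_inner_right,
    ← mul_apply_eq_comp, CFC.sqrt_mul_sqrt_self T hT]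

/-- The space of square-summable sequences in `E`. -/
abbrev SeqL2 (E : Type*) [NormedAddCommGroup E] := lp (fun _ : ℕ => E) 2

section SeqL2

variable {E : Type*} [NormedAddCommGroup E]

theorem memlp_two_iff_summable {f : ℕ → E} : Memℓp f 2 ↔ Summable fun n => ‖f n‖ ^ 2 := by
  rw [memℓp_gen_iff (by norm_num)]
  simp

theorem SeqL2.hasSum_norm_sq (f : SeqL2 E) : HasSum (fun n => ‖f n‖ ^ 2) (‖f‖ ^ 2) := by
  simpa using lp.hasSum_norm (p := 2) (by norm_num) f

variable [InnerProductSpace ℂ E]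

/-- The weighted composition operator `f ↦ (d n • f (σ n))` on square-summable sequences. -/
def SeqL2.weightedComp (d : ℕ → ℝ) (hd : ∀ n, |d n| ≤ 1) (σ : ℕ → ℕ) (hσ : σ.Injective) :
    SeqL2 E →ₗ[ℂ] SeqL2 E where
  toFun f := ⟨fun n => (d n : ℂ) • f (σ n), memlp_two_iff_summable.2 <| by
    refine Summable.of_nonneg_of_le (fun n => sq_nonneg _) (fun n => ?_)
      ((SeqL2.hasSum_norm_sq f).summable.comp_injective hσ)
    refine pow_le_pow_left₀ (norm_nonneg _) ?_ 2
    rw [norm_smul, Complex.norm_real]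
    exact mul_le_of_le_one_left (norm_nonneg _) (hd n)⟩
  map_add' f g := lp.ext (funext fun n => smul_add _ _ _)
  map_smul' a f := lp.ext (funext fun n => smul_comm _ _ _)

@[simp]
theorem SeqL2.weightedComp_apply (d : ℕ → ℝ) (hd : ∀ n, |d n| ≤ 1) (σ : ℕ → ℕ)
    (hσ : σ.Injective) (f : SeqL2 E) (n : ℕ) :
    SeqL2.weightedComp d hd σ hσ f n = (d n : ℂ) • f (σ n) := rfl

theorem SeqL2.inner_eq_of_hasSum {g f : SeqL2 E} {y v : E} {t : ℕ → ℂ}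
    (hg : ∀ n, g n = starRingEnd ℂ (t n) • y) (hv : HasSum (fun n => t n • f n) v) :
    inner ℂ g f = inner ℂ y v := by
  have h1 := lp.hasSum_inner (𝕜 := ℂ) g f
  have h2 : HasSum (fun n => inner ℂ y (t n • f n)) (inner ℂ y v) := hv.mapL (innerSL ℂ y)
  refine h1.unique (h2.congr_fun fun n => ?_)
  rw [hg, inner_smul_left, inner_smul_right, Complex.conj_conj]

end SeqL2

/-- A non-increasing weight sequence `w` together with the increments `c` of `1 / w`. -/
structure IsWeightPair (w c : ℕ → ℝ) : Prop where
  isWeightSeq : IsWeightSeq w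
  antitone : ∀ j, w (j + 1) ≤ w j
  incr_zero : c 0 = 1
  incr_succ : ∀ j, c (j + 1) = (w (j + 1))⁻¹ - (w j)⁻¹

namespace IsWeightPair

variable {w c : ℕ → ℝ} (h : IsWeightPair w c)
include h

theorem pos (n : ℕ) : 0 < w n := h.isWeightSeq.1 n

theorem sum_incr (n : ℕ) : ∑ j ∈ Finset.range (n + 1), c j = (w n)⁻¹ := by
  induction n with
  | zero => simp [h.incr_zero, h.isWeightSeq.2.1]
  | succ n ih => rw [Finset.sum_range_succ, ih, h.incr_succ]; ring

theorem incr_nonneg (n : ℕ) : 0 ≤ c n := by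
  cases n with
  | zero => rw [h.incr_zero]; exact zero_le_one
  | succ n =>
    rw [h.incr_succ, sub_nonneg]
    exact inv_anti₀ (h.pos _) (h.antitone n)

theorem incr_le (n : ℕ) : c n ≤ (w n)⁻¹ := by
  rw [← h.sum_incr, Finset.sum_range_succ]
  exact le_add_of_nonneg_left (Finset.sum_nonneg fun j _ => h.incr_nonneg j)

theorem incr_succ_mul (n : ℕ) : c (n + 1) * w (n + 1) = 1 - w (n + 1) / w n := by
  have h0 := (h.pos n).ne'
  have h1 := (h.pos (n + 1)).ne'
  rw [h.incr_succ]
  field_simp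

theorem summable_sqrt_inv {r : ℝ} (hr0 : 0 ≤ r) (hr : r < 1) :
    Summable fun n => √(w n)⁻¹ * r ^ n := by
  obtain ⟨q, hrq, hq⟩ := exists_between (pow_lt_one₀ hr0 hr two_ne_zero)
  have hq0 : 0 < q := (sq_nonneg r).trans_lt hrq
  have hev : ∀ᶠ n : ℕ in atTop, q < w n ^ ((1 : ℝ) / n) := by
    refine eventually_lt_of_lt_liminf (hq.trans_le h.isWeightSeq.2.2) ?_
    exact isBoundedUnder_of ⟨0, fun n => (Real.rpow_nonneg (h.pos n).le _)⟩
  have hlt : r * √q⁻¹ < 1 := by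
    rw [Real.sqrt_inv, ← div_eq_mul_inv, div_lt_one (Real.sqrt_pos.2 hq0)]
    exact Real.lt_sqrt_of_sq_lt hrq
  refine Summable.of_norm_bounded_eventually_nat
    (summable_geometric_of_lt_one (by positivity) hlt) ?_
  filter_upwards [hev, eventually_gt_atTop 0] with n hn hn0
  have hqn : q ^ n ≤ w n := by
    have := pow_le_pow_left₀ hq0.le hn.le n
    rwa [← Real.rpow_natCast (w n ^ _), ← Real.rpow_mul (h.pos n).le,
      one_div_mul_cancel (by positivity), Real.rpow_one] at this
  rw [Real.norm_of_nonneg (by positivity), mul_pow, mul_comm]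
  gcongr
  refine Real.sqrt_le_iff.2 ⟨by positivity, ?_⟩
  rw [← pow_mul, mul_comm n 2, pow_mul, Real.sq_sqrt (by positivity), inv_pow]
  exact inv_anti₀ (by positivity) hqn

end IsWeightPair

namespace IsWeightPair

variable {w c : ℕ → ℝ} (h : IsWeightPair w c)
include h

theorem sqrt_incr_le (n : ℕ) : √(c n) ≤ √(w n)⁻¹ := Real.sqrt_le_sqrt (h.incr_le n)

theorem abs_sqrt_incr_mul_le (n : ℕ) : |√(c n * w n)| ≤ 1 := by
  rw [abs_of_nonneg (Real.sqrt_nonneg _), Real.sqrt_le_one]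
  exact (mul_le_mul_of_nonneg_right (h.incr_le n) (h.pos n).le).trans_eq
    (inv_mul_cancel₀ (h.pos n).ne')

theorem abs_sqrt_ratio_le (n : ℕ) : |√(w (n + 1) / w n)| ≤ 1 := by
  rw [abs_of_nonneg (Real.sqrt_nonneg _), Real.sqrt_le_one]
  exact (div_le_one (h.pos n)).2 (h.antitone n)

section Operators

variable {E : Type*} [NormedAddCommGroup E] [InnerProductSpace ℂ E]

/-- The adjoint of the weighted shift, on the sequence model of the weighted Hardy space. -/
def backwardShift : SeqL2 E →ₗ[ℂ] SeqL2 E :=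
  SeqL2.weightedComp (fun n => √(w (n + 1) / w n)) h.abs_sqrt_ratio_le Nat.succ
    Nat.succ_injective

/-- The diagonal operator completing the backward shift to an isometry. -/
def diagDefect : SeqL2 E →ₗ[ℂ] SeqL2 E :=
  SeqL2.weightedComp (fun n => √(c n * w n)) h.abs_sqrt_incr_mul_le id Function.injective_id

theorem norm_sq_backwardShift_add (f : SeqL2 E) :
    ‖h.backwardShift f‖ ^ 2 + ‖h.diagDefect f‖ ^ 2 = ‖f‖ ^ 2 := by
  have h1 := SeqL2.hasSum_norm_sq (h.backwardShift f)
  have h2 := (hasSum_nat_add_iff' 1).2 (SeqL2.hasSum_norm_sq (h.diagDefect f))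
  have h3 := (hasSum_nat_add_iff' 1).2 (SeqL2.hasSum_norm_sq f)
  have h4 := h3.unique ((h1.add h2).congr_fun fun n => ?_)
  · have h0 : c 0 * w 0 = 1 := by rw [h.incr_zero, h.isWeightSeq.2.1, one_mul]
    simp only [Finset.sum_range_one, diagDefect, SeqL2.weightedComp_apply, h0, id] at h4
    simp only [Real.sqrt_one, Complex.ofReal_one, one_smul] at h4
    rw [diagDefect]
    linarith
  · simp only [backwardShift, diagDefect, SeqL2.weightedComp_apply, norm_smul, Complex.norm_real,
      Real.norm_of_nonneg (Real.sqrt_nonneg _), mul_pow, id]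
    rw [Real.sq_sqrt (div_pos (h.pos _) (h.pos _)).le,
      Real.sq_sqrt (mul_nonneg (h.incr_nonneg _) (h.pos _).le), h.incr_succ_mul]
    ring

theorem memlp_kernel {z : ℂ} (hz : z ∈ ball (0 : ℂ) 1) (y : E) :
    Memℓp (fun n => starRingEnd ℂ ((√(w n)⁻¹ : ℂ) * z ^ n) • y) 2 := by
  refine Memℓp.of_exponent_ge (q := 1) ?_ (by norm_num)
  rw [memℓp_gen_iff (by norm_num)]
  simp only [norm_smul, RCLike.norm_conj, norm_mul, norm_pow, Complex.norm_real,
    Real.norm_of_nonneg (Real.sqrt_nonneg _), ENNReal.toReal_one, Real.rpow_one]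
  exact (h.summable_sqrt_inv (norm_nonneg z) (by simpa using hz)).mul_right _

/-- The kernel vector representing evaluation at `z` against `y`. -/
def kernel {z : ℂ} (hz : z ∈ ball (0 : ℂ) 1) (y : E) : SeqL2 E := ⟨_, h.memlp_kernel hz y⟩

theorem kernel_apply {z : ℂ} (hz : z ∈ ball (0 : ℂ) 1) (y : E) (n : ℕ) :
    h.kernel hz y n = starRingEnd ℂ ((√(w n)⁻¹ : ℂ) * z ^ n) • y := rfl

theorem backwardShift_kernel {z : ℂ} (hz : z ∈ ball (0 : ℂ) 1) (y : E) :
    h.backwardShift (h.kernel hz y) = starRingEnd ℂ z • h.kernel hz y := by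
  refine lp.ext (funext fun n => ?_)
  rw [lp.coeFn_smul, Pi.smul_apply, backwardShift, SeqL2.weightedComp_apply, kernel_apply,
    kernel_apply, smul_smul, smul_smul]
  congr 1
  have : √(w (n + 1) / w n) * √(w (n + 1))⁻¹ = √(w n)⁻¹ := by
    rw [← Real.sqrt_mul (div_pos (h.pos _) (h.pos _)).le]
    congr 1
    have h1 := (h.pos n).ne'
    have h2 := (h.pos (n + 1)).ne'
    field_simp
  rw [← this]
  simp only [Nat.succ_eq_add_one, map_mul, map_pow, Complex.conj_ofReal, Complex.ofReal_mul]
  ring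

theorem summable_pow_smul {V : Type*} [NormedAddCommGroup V] [NormedSpace ℂ V]
    [CompleteSpace V] {z : ℂ} (hz : z ∈ ball (0 : ℂ) 1) {b : ℕ → V}
    {C : ℝ} (hb : ∀ n, ‖b n‖ ≤ √(w n)⁻¹ * C) : Summable fun n => z ^ n • b n := by
  refine Summable.of_norm_bounded
    ((h.summable_sqrt_inv (norm_nonneg z) (by simpa using hz)).mul_right C) fun n => ?_
  rw [norm_pow_smul_eq]
  refine (mul_le_mul_of_nonneg_left (hb n) (by positivity)).trans_eq (by ring)

theorem inner_diagDefect_kernel {z : ℂ} (hz : z ∈ ball (0 : ℂ) 1) (y : E) {f : SeqL2 E} {v : E}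
    (hv : HasSum (fun n => ((√(c n) : ℂ) * z ^ n) • f n) v) :
    inner ℂ (h.diagDefect (h.kernel hz y)) f = inner ℂ y v := by
  refine SeqL2.inner_eq_of_hasSum (fun n => ?_) hv
  rw [diagDefect, SeqL2.weightedComp_apply, kernel_apply, smul_smul]
  congr 1
  have : √(c n * w n) * √(w n)⁻¹ = √(c n) := by
    rw [← Real.sqrt_mul (mul_nonneg (h.incr_nonneg _) (h.pos _).le),
      mul_inv_cancel_right₀ (h.pos n).ne']
  rw [← this]
  simp only [id, map_mul, map_pow, Complex.conj_ofReal, Complex.ofReal_mul]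
  ring

/-- The coefficients of the power series of `Ψ`. -/
def coeffPsi (_ : IsWeightPair w c) (E : Type*) [NormedAddCommGroup E] [InnerProductSpace ℂ E]
    (n : ℕ) : SeqL2 E →L[ℂ] E :=
  (√(c n) : ℂ) • lp.evalCLM ℂ (fun _ : ℕ => E) 2 n

theorem coeffPsi_apply (n : ℕ) (f : SeqL2 E) : h.coeffPsi E n f = (√(c n) : ℂ) • f n := rfl

/-- The operator `Ψ z`. -/
def psi (E : Type*) [NormedAddCommGroup E] [InnerProductSpace ℂ E] (z : ℂ) : SeqL2 E →L[ℂ] E :=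
  ∑' n, z ^ n • h.coeffPsi E n

theorem norm_coeffPsi_le (n : ℕ) : ‖h.coeffPsi E n‖ ≤ √(w n)⁻¹ * 1 := by
  refine ContinuousLinearMap.opNorm_le_bound _ (by positivity) fun f => ?_
  rw [coeffPsi_apply, norm_smul, Complex.norm_real, Real.norm_of_nonneg (Real.sqrt_nonneg _),
    mul_one]
  exact mul_le_mul (h.sqrt_incr_le n) (lp.norm_apply_le_norm (by norm_num) f n) (norm_nonneg _)
    (Real.sqrt_nonneg _)

theorem hasSum_psi [CompleteSpace E] {z : ℂ} (hz : z ∈ ball (0 : ℂ) 1) :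
    HasSum (fun n => z ^ n • h.coeffPsi E n) (h.psi E z) := by
  have hs : Summable fun n => z ^ n • h.coeffPsi E n :=
    h.summable_pow_smul (V := SeqL2 E →L[ℂ] E) hz h.norm_coeffPsi_le
  rw [psi]
  exact hs.hasSum

theorem hasSum_psi_apply [CompleteSpace E] {z : ℂ} (hz : z ∈ ball (0 : ℂ) 1) (f : SeqL2 E) :
    HasSum (fun n => ((√(c n) : ℂ) * z ^ n) • f n) (h.psi E z f) := by
  refine ((h.hasSum_psi hz).mapL (ContinuousLinearMap.apply ℂ E f)).congr_fun fun n => ?_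
  rw [mul_comm, mul_smul]
  rfl

end Operators

end IsWeightPair

section Multiplier

variable {U Y : Type*} [NormedAddCommGroup U] [InnerProductSpace ℂ U]
  [NormedAddCommGroup Y] [InnerProductSpace ℂ Y]
  {α cα β cβ : ℕ → ℝ} {S : ℂ → (U →L[ℂ] Y)} {Sc : ℕ → (U →L[ℂ] Y)}

theorem norm_sq_ofReal_smul {E : Type*} [NormedAddCommGroup E] [NormedSpace ℂ E] {t : ℝ}
    (ht : 0 ≤ t) (x : E) : ‖(√t : ℂ) • x‖ ^ 2 = t * ‖x‖ ^ 2 := by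
  rw [norm_smul, Complex.norm_real, mul_pow, Real.norm_of_nonneg (Real.sqrt_nonneg _),
    Real.sq_sqrt ht]

/-- A contractive multiplier as a contraction between unweighted sequence spaces. -/
theorem IsContractiveMultiplierW.exists_contraction (hS : IsContractiveMultiplierW α β Sc)
    (hα : ∀ n, 0 < α n) (hβ : ∀ n, 0 < β n) :
    ∃ X : SeqL2 U →L[ℂ] SeqL2 Y, ‖X‖ ≤ 1 ∧ ∀ x n,
      X x n = (√(β n) : ℂ) • seriesConv Sc (fun k => (√(α k)⁻¹ : ℂ) • x k) n := by
  have hin : ∀ x : SeqL2 U,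
      HasSum (fun k => α k * ‖(√(α k)⁻¹ : ℂ) • x k‖ ^ 2) (‖x‖ ^ 2) := fun x => by
    refine (SeqL2.hasSum_norm_sq x).congr_fun fun k => ?_
    rw [norm_sq_ofReal_smul (inv_pos.2 (hα k)).le, mul_inv_cancel_left₀ (hα k).ne']
  have hout : ∀ x : SeqL2 U, ∀ n,
      ‖(√(β n) : ℂ) • seriesConv Sc (fun k => (√(α k)⁻¹ : ℂ) • x k) n‖ ^ 2 =
        β n * ‖∑ j ∈ Finset.range (n + 1), Sc j ((√(α (n - j))⁻¹ : ℂ) • x (n - j))‖ ^ 2 :=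
    fun x n => by rw [norm_sq_ofReal_smul (hβ n).le, seriesConv_eq_range]
  have hmem : ∀ x : SeqL2 U, Memℓp
      (fun n => (√(β n) : ℂ) • seriesConv Sc (fun k => (√(α k)⁻¹ : ℂ) • x k) n) 2 := fun x => by
    rw [memlp_two_iff_summable]
    simp only [hout]
    exact (hS _ (hin x).summable).1
  let X : SeqL2 U →ₗ[ℂ] SeqL2 Y :=
    { toFun := fun x => ⟨_, hmem x⟩
      map_add' := fun x y => lp.ext <| funext fun n => by
        simp only [seriesConv, lp.coeFn_add, Pi.add_apply, smul_add, map_add,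
          Finset.sum_add_distrib]
      map_smul' := fun a x => lp.ext <| funext fun n => by
        simp only [seriesConv, lp.coeFn_smul, Pi.smul_apply, map_smul, Finset.smul_sum,
          RingHom.id_apply]
        refine Finset.sum_congr rfl fun p _ => ?_
        rw [smul_comm _ a, smul_comm _ a] }
  have hX : ∀ x, ‖X x‖ ≤ 1 * ‖x‖ := fun x => by
    rw [one_mul, ← sq_le_sq₀ (norm_nonneg _) (norm_nonneg _), ← (hin x).tsum_eq,
      ← (SeqL2.hasSum_norm_sq (X x)).tsum_eq]
    refine le_of_eq_of_le (tsum_congr fun n => hout x n) (hS _ (hin x).summable).2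
  exact ⟨X.mkContinuous 1 hX, X.mkContinuous_norm_le zero_le_one hX, fun x n => rfl⟩

theorem adjoint_kernel_eq [CompleteSpace U] [CompleteSpace Y]
    (hα : IsWeightPair α cα) (hβ : IsWeightPair β cβ)
    (hTaylor : ∀ z ∈ ball (0 : ℂ) 1, HasSum (fun j => z ^ j • Sc j) (S z))
    {X : SeqL2 U →L[ℂ] SeqL2 Y}
    (hX : ∀ x n, X x n = (√(β n) : ℂ) • seriesConv Sc (fun k => (√(α k)⁻¹ : ℂ) • x k) n)
    {z : ℂ} (hz : z ∈ ball (0 : ℂ) 1) (y : Y) :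
    ContinuousLinearMap.adjoint X (hβ.kernel hz y) =
      hα.kernel hz (ContinuousLinearMap.adjoint (S z) y) := by
  refine ext_inner_right ℂ fun x => ?_
  have hx : ∀ ζ ∈ ball (0 : ℂ) 1, Summable fun k => ζ ^ k • ((√(α k)⁻¹ : ℂ) • x k) :=
    fun ζ hζ => hα.summable_pow_smul (C := ‖x‖) hζ fun n => by
      rw [norm_smul, Complex.norm_real, Real.norm_of_nonneg (Real.sqrt_nonneg _)]
      exact mul_le_mul_of_nonneg_left (lp.norm_apply_le_norm (by norm_num) x n)
        (Real.sqrt_nonneg _)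
  have hSx := hasSum_pow_smul_seriesConv hTaylor (fun ζ hζ => (hx ζ hζ).hasSum) z hz
  rw [ContinuousLinearMap.adjoint_inner_left, SeqL2.inner_eq_of_hasSum (hβ.kernel_apply hz y)
      (hSx.congr_fun fun n => ?_),
    SeqL2.inner_eq_of_hasSum (hα.kernel_apply hz _) ((hx z hz).hasSum.congr_fun fun n => ?_),
    ContinuousLinearMap.adjoint_inner_left]
  · rw [smul_smul, mul_comm]
  · rw [hX, smul_smul]
    congr 1
    rw [mul_right_comm, ← Complex.ofReal_mul, ← Real.sqrt_mul (inv_pos.2 (hβ.pos n)).le,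
      inv_mul_cancel₀ (hβ.pos n).ne', Real.sqrt_one, Complex.ofReal_one, one_mul]

theorem IsContractiveMultiplierW.exists_isSchur [CompleteSpace U] [CompleteSpace Y]
    (hα : IsWeightPair α cα) (hβ : IsWeightPair β cβ)
    (hTaylor : ∀ z ∈ ball (0 : ℂ) 1, HasSum (fun j => z ^ j • Sc j) (S z))
    (hS : IsContractiveMultiplierW α β Sc) :
    ∃ F : ℂ → (SeqL2 U →L[ℂ] SeqL2 Y), IsSchur F ∧
      ∀ z ∈ ball (0 : ℂ) 1, ∀ f, hβ.psi Y z (F z f) = S z (hα.psi U z f) := by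
  obtain ⟨X, hX1, hX⟩ := hS.exists_contraction hα.pos hβ.pos
  obtain ⟨D, hD⟩ := exists_norm_sq_eq_sub_norm_sq_adjoint X hX1
  set A := ContinuousLinearMap.adjoint X
  have hA : ∀ {z : ℂ} (hz : z ∈ ball (0 : ℂ) 1) (y : Y), A (hβ.kernel hz y) =
      hα.kernel hz (ContinuousLinearMap.adjoint (S z) y) :=
    fun hz y => adjoint_kernel_eq hα hβ hTaylor hX hz y
  let G : Submodule ℂ (SeqL2 Y) := Submodule.span ℂ
    {g | ∃ (z : ℂ) (hz : z ∈ ball (0 : ℂ) 1) (y : Y), hβ.kernel hz y = g}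
  have hcomm : ∀ g ∈ G, A (hβ.backwardShift g) = hα.backwardShift (A g) := by
    have : Set.EqOn (A.toLinearMap ∘ₗ hβ.backwardShift) (hα.backwardShift ∘ₗ A.toLinearMap) G := by
      refine LinearMap.eqOn_span ?_
      rintro _ ⟨z, hz, y, rfl⟩
      simp only [LinearMap.comp_apply, ContinuousLinearMap.coe_coe]
      rw [hβ.backwardShift_kernel, hA, hα.backwardShift_kernel, map_smul, hA]
    exact fun g hg => this hg
  obtain ⟨F, hF, hFz⟩ := exists_isSchur_of_lurking_isometry
    (D.toLinearMap ∘ₗ G.subtype) (D.toLinearMap ∘ₗ hβ.backwardShift ∘ₗ G.subtype)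
    (hβ.diagDefect ∘ₗ G.subtype) (hα.diagDefect ∘ₗ A.toLinearMap ∘ₗ G.subtype) fun g => by
      simp only [LinearMap.comp_apply, ContinuousLinearMap.coe_coe, Submodule.subtype_apply]
      rw [hD, hD, hcomm g g.2, ← hα.norm_sq_backwardShift_add (A g),
        ← hβ.norm_sq_backwardShift_add (g : SeqL2 Y)]
      ring
  refine ⟨F, hF, fun z hz f => ext_inner_left ℂ fun y => ?_⟩
  let g : G := ⟨hβ.kernel hz y, Submodule.subset_span ⟨z, hz, y, rfl⟩⟩
  have h1 := hFz z hz g (by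
    simp only [g, LinearMap.comp_apply, ContinuousLinearMap.coe_coe, Submodule.subtype_apply]
    rw [hβ.backwardShift_kernel, map_smul]) f
  simp only [g, LinearMap.comp_apply, ContinuousLinearMap.coe_coe, Submodule.subtype_apply] at h1
  rwa [hβ.inner_diagDefect_kernel hz y (hβ.hasSum_psi_apply hz _), hA,
    hα.inner_diagDefect_kernel hz _ (hα.hasSum_psi_apply hz _),
    ContinuousLinearMap.adjoint_inner_left] at h1

end Multiplier

theorem sum_range_sum_antidiagonal (φ : ℕ → ℕ → ℝ) (N : ℕ) :
    ∑ n ∈ Finset.range N, ∑ p ∈ Finset.HasAntidiagonal.antidiagonal n, φ p.1 p.2 =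
      ∑ j ∈ Finset.range N, ∑ i ∈ Finset.range (N - j), φ i j := by
  rw [← Finset.sum_range_diag_flip N fun j i => φ i j]
  refine Finset.sum_congr rfl fun n _ => ?_
  rw [← Finset.Nat.sum_antidiagonal_eq_sum_range_succ (fun j i => φ i j) n]
  exact (Finset.Nat.sum_antidiagonal_swap (f := fun p : ℕ × ℕ => φ p.1 p.2)).symm

namespace IsWeightPair

variable {w c : ℕ → ℝ} (h : IsWeightPair w c)
  {E : Type*} [NormedAddCommGroup E] [InnerProductSpace ℂ E]
include h

theorem sum_antidiagonal_incr (n : ℕ) :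
    ∑ p ∈ Finset.HasAntidiagonal.antidiagonal n, c p.1 = (w n)⁻¹ := by
  rw [Finset.Nat.sum_antidiagonal_eq_sum_range_succ (fun i _ => c i), h.sum_incr]

theorem norm_sq_seriesConv_coeffPsi_le (G : ℕ → SeqL2 E) (n : ℕ) :
    w n * ‖seriesConv (h.coeffPsi E) G n‖ ^ 2 ≤
      ∑ p ∈ Finset.HasAntidiagonal.antidiagonal n, ‖G p.2 p.1‖ ^ 2 := by
  have h1 : ‖seriesConv (h.coeffPsi E) G n‖ ≤
      ∑ p ∈ Finset.HasAntidiagonal.antidiagonal n, √(c p.1) * ‖G p.2 p.1‖ := by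
    refine (norm_sum_le _ _).trans_eq (Finset.sum_congr rfl fun p _ => ?_)
    rw [coeffPsi_apply, norm_smul, Complex.norm_real, Real.norm_of_nonneg (Real.sqrt_nonneg _)]
  have h2 := (pow_le_pow_left₀ (norm_nonneg _) h1 2).trans
    (Finset.sum_mul_sq_le_sq_mul_sq _ _ _)
  simp only [Real.sq_sqrt (h.incr_nonneg _), h.sum_antidiagonal_incr] at h2
  refine (mul_le_mul_of_nonneg_left h2 (h.pos n).le).trans_eq ?_
  rw [mul_inv_cancel_left₀ (h.pos n).ne']

/-- Composition with `Ψ` maps the unweighted Hardy space contractively to the weighted one. -/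
theorem sum_norm_sq_seriesConv_coeffPsi_le (G : ℕ → SeqL2 E) (N : ℕ) :
    ∑ n ∈ Finset.range N, w n * ‖seriesConv (h.coeffPsi E) G n‖ ^ 2 ≤
      ∑ n ∈ Finset.range N, ‖G n‖ ^ 2 := by
  refine (Finset.sum_le_sum fun n _ => h.norm_sq_seriesConv_coeffPsi_le G n).trans ?_
  rw [sum_range_sum_antidiagonal fun i j => ‖G j i‖ ^ 2]
  exact Finset.sum_le_sum fun j _ =>
    sum_le_hasSum _ (fun i _ => sq_nonneg _) (SeqL2.hasSum_norm_sq (G j))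

/-- Every polynomial in the weighted Hardy space is the image of one of the same norm. -/
theorem exists_seriesConv_coeffPsi_eq {x : ℕ → E} {N : ℕ} (hx : ∀ n, N ≤ n → x n = 0) :
    ∃ u : ℕ → SeqL2 E, (∀ m, N ≤ m → u m = 0) ∧
      ∑ m ∈ Finset.range N, ‖u m‖ ^ 2 = ∑ n ∈ Finset.range N, w n * ‖x n‖ ^ 2 ∧
      seriesConv (h.coeffPsi E) u = x := by
  let a : ℕ → ℕ → E := fun m j => (√(c j) : ℂ) • (w (j + m) : ℂ) • x (j + m)
  have ha : ∀ m, ∀ j ∉ Finset.range (N - m), a m j = 0 := fun m j hj => by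
    have : N ≤ j + m := by rw [Finset.mem_range] at hj; omega
    simp only [a, hx _ this, smul_zero]
  have ha2 : ∀ m, HasSum (fun j => ‖a m j‖ ^ 2) (∑ j ∈ Finset.range (N - m), ‖a m j‖ ^ 2) :=
    fun m => hasSum_sum_of_ne_finset_zero fun j hj => by rw [ha m j hj]; simp
  let u : ℕ → SeqL2 E := fun m => ⟨a m, memlp_two_iff_summable.2 (ha2 m).summable⟩
  refine ⟨u, fun m hm => lp.ext (funext fun j => ?_), ?_, funext fun n => ?_⟩
  · exact ha m j (by simp [Nat.sub_eq_zero_of_le hm])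
  · have hu : ∀ m, ‖u m‖ ^ 2 = ∑ j ∈ Finset.range (N - m), ‖a m j‖ ^ 2 :=
      fun m => (SeqL2.hasSum_norm_sq (u m)).unique (ha2 m)
    simp only [hu]
    rw [← sum_range_sum_antidiagonal fun j m => ‖a m j‖ ^ 2]
    refine Finset.sum_congr rfl fun n _ => ?_
    have : ∀ p ∈ Finset.HasAntidiagonal.antidiagonal n,
        ‖a p.2 p.1‖ ^ 2 = c p.1 * (w n ^ 2 * ‖x n‖ ^ 2) := fun p hp => by
      simp only [a, Finset.HasAntidiagonal.mem_antidiagonal.1 hp]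
      rw [norm_sq_ofReal_smul (h.incr_nonneg _), norm_smul, Complex.norm_real,
        Real.norm_of_nonneg (h.pos n).le, mul_pow]
    rw [Finset.sum_congr rfl this, ← Finset.sum_mul, h.sum_antidiagonal_incr]
    have := (h.pos n).ne'
    field_simp
  · have : ∀ p ∈ Finset.HasAntidiagonal.antidiagonal n,
        h.coeffPsi E p.1 (u p.2) = ((c p.1 * w n : ℝ) : ℂ) • x n := fun p hp => by
      rw [coeffPsi_apply]
      simp only [u, a, Finset.HasAntidiagonal.mem_antidiagonal.1 hp, smul_smul]
      rw [← Complex.ofReal_mul, ← Complex.ofReal_mul, ← mul_assoc,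
        Real.mul_self_sqrt (h.incr_nonneg _)]
    rw [seriesConv, Finset.sum_congr rfl this, ← Finset.sum_smul, ← Complex.ofReal_sum,
      ← Finset.sum_mul, h.sum_antidiagonal_incr, inv_mul_cancel₀ (h.pos n).ne',
      Complex.ofReal_one, one_smul]

end IsWeightPair

theorem hasSum_pow_smul_of_eq_zero {E : Type*} [NormedAddCommGroup E] [NormedSpace ℂ E]
    {e : ℕ → E} {N : ℕ} (he : ∀ n, N ≤ n → e n = 0) (z : ℂ) :
    HasSum (fun n => z ^ n • e n) (∑ n ∈ Finset.range N, z ^ n • e n) :=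
  hasSum_sum_of_ne_finset_zero fun n hn => by rw [he n (by simpa using hn), smul_zero]

theorem isContractiveMultiplierW_of_isSchur {U Y : Type*}
    [NormedAddCommGroup U] [InnerProductSpace ℂ U] [CompleteSpace U]
    [NormedAddCommGroup Y] [InnerProductSpace ℂ Y] [CompleteSpace Y]
    {α cα β cβ : ℕ → ℝ} {S : ℂ → (U →L[ℂ] Y)} {Sc : ℕ → (U →L[ℂ] Y)}
    (hα : IsWeightPair α cα) (hβ : IsWeightPair β cβ)
    (hTaylor : ∀ z ∈ ball (0 : ℂ) 1, HasSum (fun j => z ^ j • Sc j) (S z))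
    {F : ℂ → (SeqL2 U →L[ℂ] SeqL2 Y)} (hF : IsSchur F)
    (hSF : ∀ z ∈ ball (0 : ℂ) 1, ∀ f, hβ.psi Y z (F z f) = S z (hα.psi U z f)) :
    IsContractiveMultiplierW α β Sc := by
  obtain ⟨L, hL⟩ := hF.exists_hasSum
  have hpoly : ∀ (x : ℕ → U) (N : ℕ), (∀ n, N ≤ n → x n = 0) →
      ∑ n ∈ Finset.range N, β n * ‖seriesConv Sc x n‖ ^ 2 ≤
        ∑ n ∈ Finset.range N, α n * ‖x n‖ ^ 2 := fun x N hx => by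
    obtain ⟨u, hu0, hu, hux⟩ := hα.exists_seriesConv_coeffPsi_eq hx
    let uf : ℂ → SeqL2 U := fun z => ∑ n ∈ Finset.range N, z ^ n • u n
    have hu' : ∀ z ∈ ball (0 : ℂ) 1, HasSum (fun n => z ^ n • u n) (uf z) :=
      fun z _ => hasSum_pow_smul_of_eq_zero hu0 z
    have hl := hasSum_pow_smul_seriesConv (Lf := hβ.psi Y) (fun z hz => hβ.hasSum_psi hz)
      (hasSum_pow_smul_seriesConv hL hu')
    have hr := hasSum_pow_smul_seriesConv hTaylor
      (hasSum_pow_smul_seriesConv (Lf := hα.psi U) (fun z hz => hα.hasSum_psi hz) hu')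
    rw [hux] at hr
    have heq := eq_of_hasSum_pow_smul (f := fun z => S z (hα.psi U z (uf z)))
      (fun z hz => hSF z hz (uf z) ▸ hl z hz) hr
    rw [← heq, ← hu]
    exact (hβ.sum_norm_sq_seriesConv_coeffPsi_le _ N).trans (hF.sum_norm_sq_seriesConv_le hL hu0)
  intro x hx
  have hbound : ∀ N, ∑ ℓ ∈ Finset.range N,
      β ℓ * ‖∑ j ∈ Finset.range (ℓ + 1), Sc j (x (ℓ - j))‖ ^ 2 ≤ ∑' k, α k * ‖x k‖ ^ 2 :=
    fun N => by
    have h1 := hpoly (fun n => if n < N then x n else 0) N fun n hn => if_neg hn.not_gt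
    refine (le_of_eq_of_le (Finset.sum_congr rfl fun n hn => ?_) h1).trans
      (le_of_eq_of_le (Finset.sum_congr rfl fun n hn => ?_)
        (hx.sum_le_tsum (Finset.range N) fun n _ => ?_))
    · rw [seriesConv_eq_range]
      congr 3
      refine Finset.sum_congr rfl fun j _ => ?_
      rw [if_pos ((Nat.sub_le n j).trans_lt (Finset.mem_range.1 hn))]
    · rw [if_pos (Finset.mem_range.1 hn)]
    · exact mul_nonneg (hα.pos n).le (sq_nonneg _)
  have hnonneg : ∀ ℓ, 0 ≤ β ℓ * ‖∑ j ∈ Finset.range (ℓ + 1), Sc j (x (ℓ - j))‖ ^ 2 :=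
    fun ℓ => mul_nonneg (hβ.pos ℓ).le (sq_nonneg _)
  exact ⟨summable_of_sum_range_le hnonneg hbound, Real.tsum_le_of_sum_range_le hnonneg hbound⟩

theorem stmt11 {U Y : Type*}
    [NormedAddCommGroup U] [InnerProductSpace ℂ U] [CompleteSpace U]
    [NormedAddCommGroup Y] [InnerProductSpace ℂ Y] [CompleteSpace Y]
    (α : ℕ → ℝ) (hα : IsWeightSeq α) (hαmono : ∀ j, α (j + 1) ≤ α j)
    (β : ℕ → ℝ) (hβ : IsWeightSeq β) (hβmono : ∀ j, β (j + 1) ≤ β j)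
    (cα : ℕ → ℝ) (hcα0 : cα 0 = 1) (hcαs : ∀ j, cα (j + 1) = (α (j + 1))⁻¹ - (α j)⁻¹)
    (cβ : ℕ → ℝ) (hcβ0 : cβ 0 = 1) (hcβs : ∀ j, cβ (j + 1) = (β (j + 1))⁻¹ - (β j)⁻¹)
    (S : ℂ → (U →L[ℂ] Y)) (Sc : ℕ → (U →L[ℂ] Y))
    (hTaylor : ∀ z ∈ ball (0 : ℂ) 1, HasSum (fun j => z ^ j • Sc j) (S z)) :
    IsContractiveMultiplierW α β Sc ↔
      ∃ F : ℂ → (lp (fun _ : ℕ => U) 2 →L[ℂ] lp (fun _ : ℕ => Y) 2),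
        IsSchur F ∧
        -- `S(z) Ψ_α(z) = Ψ_β(z) F(z)` as operators from `ℓ²(U)` to `Y`
        ∀ z ∈ ball (0 : ℂ) 1, ∀ f : lp (fun _ : ℕ => U) 2, ∃ v : U,
          HasSum (fun j => ((Real.sqrt (cα j) : ℂ) * z ^ j) • (f j)) v ∧
          HasSum (fun j => ((Real.sqrt (cβ j) : ℂ) * z ^ j) • (F z f) j) (S z v) := by
  have hαp : IsWeightPair α cα := ⟨hα, hαmono, hcα0, hcαs⟩
  have hβp : IsWeightPair β cβ := ⟨hβ, hβmono, hcβ0, hcβs⟩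
  constructor
  · intro hS
    obtain ⟨F, hF, hSF⟩ := hS.exists_isSchur hαp hβp hTaylor
    exact ⟨F, hF, fun z hz f => ⟨hαp.psi U z f, hαp.hasSum_psi_apply hz f,
      hSF z hz f ▸ hβp.hasSum_psi_apply hz (F z f)⟩⟩
  · rintro ⟨F, hF, hSF⟩
    refine isContractiveMultiplierW_of_isSchur hαp hβp hTaylor hF fun z hz f => ?_
    obtain ⟨v, hv, hSv⟩ := hSF z hz f
    rw [(hαp.hasSum_psi_apply hz f).unique hv, (hβp.hasSum_psi_apply hz (F z f)).unique hSv]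
end
end

section
/- Let S : 𝔻 → ℂ be analytic and suppose the kernel K(z,ζ) = (1 − z·conj ζ)^{-3} − (1 − z·conj ζ)^{-2} S(z)·conj(S(ζ)) is positive on 𝔻 × 𝔻, i.e., for all finitely many points z_1,…,z_m ∈ 𝔻 and scalars a_1,…,a_m ∈ ℂ one has Σ_{i,l=1}^{m} a_i · conj(a_l) · K(z_i, z_l) ≥ 0. If S(1/√2) = √(26/15) and S(−1/√2) = −√(26/15), then S(z) = √(15/13) · z(z² + 6)/(4 − z⁴) for all z ∈ 𝔻. -/
open Metric Filter

noncomputable section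

/-- `K` is a positive kernel on 𝔻 × 𝔻. -/
def IsPosKernel (K : ℂ → ℂ → ℂ) : Prop :=
  ∀ (m : ℕ) (zs : Fin m → ℂ), (∀ i, zs i ∈ ball (0 : ℂ) 1) → ∀ a : Fin m → ℂ,
    0 ≤ (∑ i, ∑ l, a i * starRingEnd ℂ (a l) * K (zs i) (zs l)).re ∧
    (∑ i, ∑ l, a i * starRingEnd ℂ (a l) * K (zs i) (zs l)).im = 0

theorem IsPosKernel.apply_eq_of_null {K : ℂ → ℂ → ℂ} (hK : IsPosKernel K)
    (hherm : ∀ z w, K w z = starRingEnd ℂ (K z w)) {p q z : ℂ}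
    (hp : p ∈ ball (0 : ℂ) 1) (hq : q ∈ ball (0 : ℂ) 1) (hz : z ∈ ball (0 : ℂ) 1)
    (h0 : K p p - K p q - K q p + K q q = 0) : K z p = K z q := by
  set u := K z p - K z q with hu
  have key : ∀ s : ℝ, 0 ≤ (K z z).re * (s * s) + (-2 * Complex.normSq u) * s + 0 := by
    intro s
    have h := (hK 3 ![z, p, q] (by intro i; fin_cases i <;> assumption)
      ![(s : ℂ), -u, u]).1
    have e : (∑ i, ∑ l, (![(s : ℂ), -u, u] i) * starRingEnd ℂ (![(s : ℂ), -u, u] l)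
        * K (![z, p, q] i) (![z, p, q] l))
        = s * s * K z z - s * (starRingEnd ℂ u * u) - s * (u * starRingEnd ℂ u)
          + u * starRingEnd ℂ u * (K p p - K p q - K q p + K q q) := by
      simp only [Fin.sum_univ_three, Matrix.cons_val, map_neg, Complex.conj_ofReal]
      rw [hherm z p, hherm z q, hu, map_sub]
      ring
    rw [e, h0, mul_comm (starRingEnd ℂ u), Complex.mul_conj] at h
    simp only [← Complex.ofReal_mul, mul_zero, add_zero, Complex.sub_re, Complex.re_ofReal_mul,
      Complex.ofReal_re] at h
    linarith
  have h := discrim_le_zero key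
  rw [discrim] at h
  have h' : Complex.normSq u = 0 := by nlinarith [sq_nonneg (Complex.normSq u)]
  exact sub_eq_zero.1 (Complex.normSq_eq_zero.1 h')

theorem stmt13 (S : ℂ → ℂ) (hS : AnalyticOn ℂ S (ball 0 1))
    (hpos : IsPosKernel (fun z ζ =>
      ((1 - z * starRingEnd ℂ ζ) ^ 3)⁻¹
        - ((1 - z * starRingEnd ℂ ζ) ^ 2)⁻¹ * S z * starRingEnd ℂ (S ζ)))
    (h1 : S ((Real.sqrt 2 : ℝ)⁻¹ : ℂ) = (Real.sqrt (26 / 15) : ℂ))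
    (h2 : S (-((Real.sqrt 2 : ℝ)⁻¹ : ℂ)) = -(Real.sqrt (26 / 15) : ℂ)) :
    ∀ z ∈ ball (0 : ℂ) 1,
      S z = (Real.sqrt (15 / 13) : ℂ) * (z * (z ^ 2 + 6)) / (4 - z ^ 4) := by
  intro z hz
  set r : ℂ := ((Real.sqrt 2 : ℝ)⁻¹ : ℂ) with hr
  set c : ℂ := (Real.sqrt (26 / 15) : ℂ) with hc
  have hrr : starRingEnd ℂ r = r := by rw [hr, map_inv₀, Complex.conj_ofReal]
  have hcc : starRingEnd ℂ c = c := Complex.conj_ofReal _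
  have hr2 : r ^ 2 = 1 / 2 := by
    rw [hr, inv_pow, ← Complex.ofReal_pow, Real.sq_sqrt (by norm_num)]
    norm_num
  have hc2 : c ^ 2 = 26 / 15 := by
    rw [hc, ← Complex.ofReal_pow, Real.sq_sqrt (by norm_num)]
    norm_num
  have hrn : ‖r‖ < 1 := by
    have h : ‖r‖ ^ 2 = 1 / 2 := by rw [← norm_pow, hr2]; norm_num
    nlinarith [norm_nonneg r]
  have hz1 : ‖z‖ < 1 := by simpa using hz
  have hker := hpos.apply_eq_of_null (p := r) (q := -r)
    (by
      intro z w
      simp only [map_sub, map_mul, map_inv₀, map_pow, map_one, Complex.conj_conj]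
      ring)
    (by simpa using hrn) (by simpa using hrn) hz
    (by
      simp only [h1, h2, map_neg, hrr, hcc]
      have e1 : r * r = 1 / 2 := by rw [← hr2]; ring
      have e2 : c * c = 26 / 15 := by rw [← hc2]; ring
      simp only [mul_neg, neg_mul, neg_neg, mul_assoc, e1, e2]
      norm_num)
  simp only [h1, h2, map_neg, hrr, hcc, mul_neg, sub_neg_eq_add] at hker
  have hzr : ‖z * r‖ < 1 := by
    rw [norm_mul]
    nlinarith [norm_nonneg r, norm_nonneg z]
  have hm : 1 - z * r ≠ 0 := by
    intro h
    rw [← sub_eq_zero.1 h] at hzr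
    simp at hzr
  have hp : 1 + z * r ≠ 0 := by
    intro h
    rw [eq_neg_of_add_eq_zero_right h] at hzr
    simp at hzr
  have hd : 4 - z ^ 4 ≠ 0 := by
    intro h
    have h4 : ‖z‖ ^ 4 = 4 := by rw [← norm_pow, ← sub_eq_zero.1 h]; norm_num
    have : ‖z‖ ^ 4 < 1 := pow_lt_one₀ (norm_nonneg z) hz1 (by norm_num)
    linarith
  have hc0 : c ≠ 0 := by
    intro h
    norm_num [h] at hc2
  have hsqrt : (Real.sqrt (15 / 13) : ℂ) * c = 2 * r := by
    have h2r : 2 * r = (Real.sqrt 2 : ℂ) := by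
      have h : (Real.sqrt 2 : ℂ) ^ 2 = 2 := by
        rw [← Complex.ofReal_pow, Real.sq_sqrt (by norm_num)]
        norm_num
      have h0 : (Real.sqrt 2 : ℂ) ≠ 0 := by
        intro h'
        norm_num [h'] at h
      rw [hr, ← div_eq_mul_inv, div_eq_iff h0, ← h]
      ring
    rw [h2r, hc, ← Complex.ofReal_mul, ← Real.sqrt_mul (by norm_num)]
    norm_num
  have hcross : (1 + z * r) ^ 3 - (1 - z * r) ^ 3
      = S z * c * ((1 - z * r) * (1 + z * r) ^ 3 + (1 + z * r) * (1 - z * r) ^ 3) := by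
    field_simp at hker
    linear_combination hker
  rw [eq_div_iff hd]
  apply mul_right_cancel₀ hc0
  have hr3 : r ^ 3 = r / 2 := by linear_combination r * hr2
  have hr4 : r ^ 4 = 1 / 4 := by linear_combination (r ^ 2 + 1 / 2) * hr2
  linear_combination -2 * hcross - z * (z ^ 2 + 6) * hsqrt
    + 4 * z ^ 3 * hr3 + 4 * S z * c * z ^ 4 * hr4
end
end

section
/- Fix an integer n ≥ 2 and let β_j = j!·(n−1)!/(n+j−1)! for j ≥ 0 (the weight sequence of the standard weighted Bergman space A²_n, so that β_j^{-1} = binom(n+j−1, j)). Then the Pick number P_n := Σ_{j≥0} β_j^{-1} (9/16)^j − Σ_{j≥0} (16/9)(9/16)^j = (16/7)^n − 256/63 is positive, and there exists an analytic function S : 𝔻 → ℂ which is a contractive multiplier from H² to H²_β and satisfies S(3/4) = 4/3. -/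
open Metric

noncomputable section

/-- `S`, with Taylor coefficients `Sc`, is a (scalar-valued) contractive multiplier
from `H²` to `H²_β`. -/
def IsContractiveMultiplierC (β : ℕ → ℝ) (Sc : ℕ → ℂ) : Prop :=
  ∀ h : ℕ → ℂ, Summable (fun k => ‖h k‖ ^ 2) →
    Summable (fun ℓ => β ℓ * ‖∑ j ∈ Finset.range (ℓ + 1), Sc j * h (ℓ - j)‖ ^ 2) ∧
    ∑' ℓ, β ℓ * ‖∑ j ∈ Finset.range (ℓ + 1), Sc j * h (ℓ - j)‖ ^ 2 ≤ ∑' k, ‖h k‖ ^ 2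

theorem inv_weight_eq_choose {n : ℕ} (hn : 1 ≤ n) (j : ℕ) :
    ((j.factorial * (n - 1).factorial : ℝ) / (n + j - 1).factorial)⁻¹
      = ((n + j - 1).choose j : ℝ) := by
  rw [Nat.cast_choose ℝ (by omega : j ≤ n + j - 1), inv_div,
    show n + j - 1 - j = n - 1 by omega]

theorem succ_le_choose {n : ℕ} (hn : 2 ≤ n) (j : ℕ) : j + 1 ≤ (n + j - 1).choose j := by
  calc j + 1 = (j + 1).choose j := by simp
    _ ≤ (n + j - 1).choose j := Nat.choose_le_choose j (by omega)

/-- The Cauchy product of two square-summable sequences, with squared coefficients weighted by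
at most `1 / (ℓ + 1)`, is controlled by the product of the `ℓ²` norms. -/
theorem isContractiveMultiplierC_of_tsum_le_one {β : ℕ → ℝ} {Sc : ℕ → ℂ}
    (hβ0 : ∀ ℓ, 0 ≤ β ℓ) (hβ1 : ∀ ℓ, β ℓ * (ℓ + 1) ≤ 1)
    (hS : Summable fun j => ‖Sc j‖ ^ 2) (hS1 : ∑' j, ‖Sc j‖ ^ 2 ≤ 1) :
    IsContractiveMultiplierC β Sc := by
  intro h hh
  have hle : ∀ ℓ, β ℓ * ‖∑ j ∈ Finset.range (ℓ + 1), Sc j * h (ℓ - j)‖ ^ 2 ≤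
      ∑ j ∈ Finset.range (ℓ + 1), ‖Sc j‖ ^ 2 * ‖h (ℓ - j)‖ ^ 2 := by
    intro ℓ
    set T := ∑ j ∈ Finset.range (ℓ + 1), ‖Sc j‖ ^ 2 * ‖h (ℓ - j)‖ ^ 2 with hT
    have hT0 : 0 ≤ T := by positivity
    have hCS : ‖∑ j ∈ Finset.range (ℓ + 1), Sc j * h (ℓ - j)‖ ^ 2 ≤ (ℓ + 1) * T := by
      calc ‖∑ j ∈ Finset.range (ℓ + 1), Sc j * h (ℓ - j)‖ ^ 2
          ≤ (∑ j ∈ Finset.range (ℓ + 1), ‖Sc j * h (ℓ - j)‖) ^ 2 := by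
            gcongr
            exact norm_sum_le _ _
        _ ≤ (ℓ + 1) * T := by
            have := sq_sum_le_card_mul_sum_sq (s := Finset.range (ℓ + 1))
              (f := fun j => ‖Sc j * h (ℓ - j)‖)
            simpa [mul_pow, hT] using this
    calc _ ≤ β ℓ * ((ℓ + 1) * T) := mul_le_mul_of_nonneg_left hCS (hβ0 ℓ)
      _ = β ℓ * (ℓ + 1) * T := by ring
      _ ≤ 1 * T := mul_le_mul_of_nonneg_right (hβ1 ℓ) hT0
      _ = T := one_mul T
  have hSn : Summable fun j => ‖‖Sc j‖ ^ 2‖ := hS.norm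
  have hhn : Summable fun j => ‖‖h j‖ ^ 2‖ := hh.norm
  have hsum := (summable_norm_sum_mul_range_of_summable_norm hSn hhn).of_norm
  have hsum' := Summable.of_nonneg_of_le
    (fun ℓ => mul_nonneg (hβ0 ℓ) (sq_nonneg _)) hle hsum
  refine ⟨hsum', (hsum'.tsum_le_tsum hle hsum).trans ?_⟩
  rw [← tsum_mul_tsum_eq_tsum_sum_range_of_summable_norm hSn hhn]
  exact mul_le_of_le_one_left (tsum_nonneg fun _ => sq_nonneg _) hS1

theorem stmt16 (n : ℕ) (hn : 2 ≤ n)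
    (β : ℕ → ℝ)
    (hβ : ∀ j, β j = (j.factorial * (n - 1).factorial : ℝ) / (n + j - 1).factorial) :
    -- `β_j⁻¹` is the binomial coefficient `(n+j-1).choose j`
    (∀ j, (β j)⁻¹ = ((n + j - 1).choose j : ℝ)) ∧
    -- the Pick number `P_n` equals `(16/7)^n - 256/63` ...
    (∑' j, (β j)⁻¹ * (9 / 16 : ℝ) ^ j) - (∑' j, (16 / 9 : ℝ) * (9 / 16 : ℝ) ^ j)
      = (16 / 7 : ℝ) ^ n - 256 / 63 ∧
    -- ... and is positive ...
    0 < (16 / 7 : ℝ) ^ n - 256 / 63 ∧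
    -- ... and there is a contractive multiplier from `H²` to `H²_β = A²_n`
    -- with `S(3/4) = 4/3`
    ∃ (S : ℂ → ℂ) (Sc : ℕ → ℂ),
      (∀ z ∈ ball (0 : ℂ) 1, HasSum (fun j => Sc j * z ^ j) (S z)) ∧
      IsContractiveMultiplierC β Sc ∧
      S (3 / 4) = 4 / 3 := by
  have hinv : ∀ j, (β j)⁻¹ = ((n + j - 1).choose j : ℝ) := fun j => by
    rw [hβ, inv_weight_eq_choose (by omega)]
  have hpos : ∀ j, 0 < β j := fun j => by
    rw [hβ]
    positivity
  refine ⟨hinv, ?_, ?_, ?_⟩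
  · have hchoose := tsum_choose_mul_geometric_of_norm_lt_one (n - 1)
      (show ‖(9 / 16 : ℝ)‖ < 1 by norm_num)
    have hterm : ∀ j, (β j)⁻¹ * (9 / 16 : ℝ) ^ j
        = ((j + (n - 1)).choose (n - 1) : ℝ) * (9 / 16) ^ j := fun j => by
      rw [hinv, show n + j - 1 = j + (n - 1) by omega, Nat.choose_symm_add]
    simp_rw [hterm]
    rw [hchoose, tsum_mul_left, tsum_geometric_of_lt_one (by norm_num) (by norm_num),
      Nat.sub_add_cancel (by omega), ← one_div_pow]
    norm_num
  · have : (16 / 7 : ℝ) ^ 2 ≤ (16 / 7 : ℝ) ^ n := pow_le_pow_right₀ (by norm_num) hn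
    linarith [show (256 / 63 : ℝ) < (16 / 7) ^ 2 by norm_num]
  · -- a multiple of the Szegő kernel at `3 / 4`
    refine ⟨fun z => 7 / 12 * (1 - 3 / 4 * z)⁻¹, fun j => 7 / 12 * (3 / 4) ^ j, ?_, ?_, ?_⟩
    · intro z hz
      have hz1 : ‖z‖ < 1 := by simpa using hz
      have hlt : ‖3 / 4 * z‖ < 1 := by
        rw [norm_mul]
        norm_num
        linarith
      simpa [mul_pow, mul_assoc] using (hasSum_geometric_of_norm_lt_one hlt).mul_left (7 / 12)
    · have hnorm : HasSum (fun j : ℕ => ‖(7 / 12 * (3 / 4) ^ j : ℂ)‖ ^ 2) (7 / 9) := by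
        have hgeom := (hasSum_geometric_of_lt_one (show (0 : ℝ) ≤ 9 / 16 by norm_num)
          (by norm_num)).mul_left (49 / 144)
        rw [show (49 / 144 * (1 - 9 / 16)⁻¹ : ℝ) = 7 / 9 by norm_num] at hgeom
        have hterm : ∀ j : ℕ, ‖(7 / 12 * (3 / 4) ^ j : ℂ)‖ ^ 2 = 49 / 144 * (9 / 16) ^ j := by
          intro j
          rw [norm_mul, norm_pow, mul_pow, ← pow_mul, mul_comm j 2, pow_mul]
          norm_num
        simpa only [hterm] using hgeom
      refine isContractiveMultiplierC_of_tsum_le_one (fun ℓ => (hpos ℓ).le) (fun ℓ => ?_)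
        hnorm.summable (by rw [hnorm.tsum_eq]; norm_num)
      rw [← le_div_iff₀' (hpos ℓ), one_div, hinv]
      exact_mod_cast succ_le_choose hn ℓ
    · norm_num
end
end
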